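/- arXiv:2210.04549 — 3 statements merged into one kernel-verified Lean document; each statement's English description precedes it below -/
import Mathlib

section
/- Let I be a d-dimensional pasting shape and 0 ≤ k ≤ d. Then tr_{≤k} I = ⋃_{H ∈ ℋ_k} (I ∩ H), and, as d-uple simplicial subsets of [I], tr_{≤k}[I] = [tr_{≤k} I] = ⋃_{H ∈ ℋ_k} [I ∩ H]. -/
namespace Pasting

/-- A point of `ℕ^d`. -/
abbrev Vtx (d : ℕ) := Fin d → ℕ

variable {d : ℕ}

/-- `(x, y)` is a box: `x ≤ y` coordinatewise. -/
def IsBoxPair (x y : Vtx d) : Prop := ∀ a, x a ≤ y a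

/-- The number of non-degenerate directions of a box. -/
def boxDim (x y : Vtx d) : ℕ := (Finset.univ.filter fun a => x a ≠ y a).card

/-- `(x', y')` is a face of the box `(x, y)`. -/
def IsFaceOf (x' y' x y : Vtx d) : Prop :=
  (∀ a, (x' a = x a ∨ x' a = y a) ∧ (y' a = x a ∨ y' a = y a)) ∧ IsBoxPair x' y'

/-- Adjacency of boxes: they agree except possibly at one special index where the
second box continues the first; the join is then `(x, y')`. -/
def Adjacent (x y x' y' : Vtx d) : Prop :=
  IsBoxPair x y ∧ IsBoxPair x' y' ∧
  (∀ a, (x a = x' a ∧ y a = y' a) ∨ (x a < y a ∧ y a = x' a ∧ x' a < y' a)) ∧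
  ∀ a b, ¬(x a = x' a ∧ y a = y' a) → ¬(x b = x' b ∧ y b = y' b) → a = b

theorem Adjacent.boxPair_join {x y x' y' : Vtx d} (h : Adjacent x y x' y') :
    IsBoxPair x y' := by
  intro a
  have h1 := h.1 a
  have h2 := h.2.1 a
  rcases h.2.2.1 a with ⟨e1, e2⟩ | ⟨l1, e2, l2⟩ <;> omega

/-- A `d`-dimensional pasting shape: a set of boxes in `ℕ^d` closed under faces and
joins of adjacent boxes. -/
structure PastingShape (d : ℕ) where
  boxes : Set (Vtx d × Vtx d)
  isBox' : ∀ p ∈ boxes, IsBoxPair p.1 p.2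
  face_closed' : ∀ p ∈ boxes, ∀ x' y' : Vtx d, IsFaceOf x' y' p.1 p.2 → (x', y') ∈ boxes
  join_closed' : ∀ x y x' y' : Vtx d, (x, y) ∈ boxes → (x', y') ∈ boxes →
    Adjacent x y x' y' → (x, y') ∈ boxes

namespace PastingShape

theorem ext_boxes : ∀ {I J : PastingShape d}, I.boxes = J.boxes → I = J := by
  rintro ⟨b, _, _, _⟩ ⟨b', _, _, _⟩ rfl
  rfl

/-- Subshape relation. -/
instance : LE (PastingShape d) := ⟨fun I J => I.boxes ⊆ J.boxes⟩

theorem le_iff {I J : PastingShape d} : I ≤ J ↔ I.boxes ⊆ J.boxes := Iff.rfl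

theorem le_boxes {I J : PastingShape d} (h : I ≤ J) : I.boxes ⊆ J.boxes := le_iff.mp h

/-- The vertices of a pasting shape. -/
def vertices (I : PastingShape d) : Set (Vtx d) := {x | (x, x) ∈ I.boxes}

theorem fst_mem_vertices {I : PastingShape d} {x y : Vtx d} (h : (x, y) ∈ I.boxes) :
    x ∈ I.vertices :=
  I.face_closed' _ h x x ⟨fun _ => ⟨Or.inl rfl, Or.inl rfl⟩, fun _ => le_rfl⟩

theorem snd_mem_vertices {I : PastingShape d} {x y : Vtx d} (h : (x, y) ∈ I.boxes) :
    y ∈ I.vertices :=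
  I.face_closed' _ h y y ⟨fun _ => ⟨Or.inr rfl, Or.inr rfl⟩, fun _ => le_rfl⟩

end PastingShape

open PastingShape

/-- A map of pasting shapes: a map on vertices carrying boxes to boxes and preserving
degenerate coordinates. -/
structure Hom (I J : PastingShape d) where
  toFun : I.vertices → J.vertices
  map_box : ∀ x y : I.vertices, ((x : Vtx d), (y : Vtx d)) ∈ I.boxes →
    ((toFun x : Vtx d), (toFun y : Vtx d)) ∈ J.boxes
  map_deg : ∀ x y : I.vertices, ((x : Vtx d), (y : Vtx d)) ∈ I.boxes →
    ∀ a, (x : Vtx d) a = (y : Vtx d) a → (toFun x : Vtx d) a = (toFun y : Vtx d) a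

theorem Hom.ext {I J : PastingShape d} {f g : Hom I J} (h : f.toFun = g.toFun) : f = g := by
  cases f; cases g; cases h; rfl

/-- Identity map of pasting shapes. -/
def Hom.id (I : PastingShape d) : Hom I I :=
  ⟨fun x => x, fun _ _ h => h, fun _ _ _ _ h => h⟩

/-- Composition of maps of pasting shapes. -/
def Hom.comp {I J K : PastingShape d} (g : Hom J K) (f : Hom I J) : Hom I K where
  toFun := g.toFun ∘ f.toFun
  map_box x y h := g.map_box _ _ (f.map_box x y h)
  map_deg x y h a ha := g.map_deg _ _ (f.map_box x y h) a (f.map_deg x y h a ha)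

open Classical in
/-- The underlying map on `ℕ^d`, extended by the identity outside the vertices. -/
noncomputable def Hom.vApp {I J : PastingShape d} (f : Hom I J) (x : Vtx d) : Vtx d :=
  if h : x ∈ I.vertices then (f.toFun ⟨x, h⟩ : Vtx d) else x

theorem Hom.vApp_box {I J : PastingShape d} (f : Hom I J) {p : Vtx d × Vtx d}
    (hp : p ∈ I.boxes) : (f.vApp p.1, f.vApp p.2) ∈ J.boxes := by
  have h1 := fst_mem_vertices hp
  have h2 := snd_mem_vertices hp
  rw [Hom.vApp, Hom.vApp, dif_pos h1, dif_pos h2]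
  exact f.map_box ⟨p.1, h1⟩ ⟨p.2, h2⟩ hp

/-- The inclusion of a subshape. -/
def inclHom {F I : PastingShape d} (h : F ≤ I) : Hom F I where
  toFun x := ⟨(x : Vtx d), le_boxes h x.2⟩
  map_box _ _ hb := le_boxes h hb
  map_deg _ _ _ _ ha := ha

/-- The standard grid `□[n₁,…,n_d]`. -/
def stdGrid (d : ℕ) (n : Vtx d) : PastingShape d where
  boxes := {p | ∀ a, p.1 a ≤ p.2 a ∧ p.2 a ≤ n a}
  isBox' p hp a := (hp a).1
  face_closed' := by
    rintro ⟨x, y⟩ hp x' y' ⟨hf, hbp⟩ a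
    refine ⟨hbp a, ?_⟩
    show y' a ≤ n a
    have h1 : x a ≤ y a := (hp a).1
    have h2 : y a ≤ n a := (hp a).2
    have h3 : y' a = x a ∨ y' a = y a := (hf a).2
    omega
  join_closed' := by
    intro x y x' y' h h' hadj a
    exact ⟨hadj.boxPair_join a, (h' a).2⟩

theorem mem_stdGrid_vertices {n x : Vtx d} :
    x ∈ (stdGrid d n).vertices ↔ ∀ a, x a ≤ n a := by
  show (∀ a, x a ≤ x a ∧ x a ≤ n a) ↔ _
  exact ⟨fun h a => (h a).2, fun h a => ⟨le_rfl, h a⟩⟩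

/-- The vertex of the grid sitting at `i` in direction `a` and at `0` elsewhere. -/
def unitVtx (a : Fin d) (i : ℕ) : Vtx d := fun b => if b = a then i else 0

theorem unitVtx_mem {n : Vtx d} {a : Fin d} {i : ℕ} (h : i ≤ n a) :
    unitVtx a i ∈ (stdGrid d n).vertices := by
  rw [mem_stdGrid_vertices]
  intro b
  unfold unitVtx
  by_cases hb : b = a
  · subst hb; simpa using h
  · simp [hb]

/-- The components `f_a : [n_a] → ℕ` of a map out of a standard grid. -/
def gcpt {n : Vtx d} {I : PastingShape d} (f : Hom (stdGrid d n) I) (a : Fin d)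
    (i : Fin (n a + 1)) : ℕ :=
  (f.toFun ⟨unitVtx a i, unitVtx_mem (Nat.lt_succ_iff.mp i.isLt)⟩ : Vtx d) a

/-- The image `im(f_a)` of the `a`-th component of a map out of a standard grid. -/
def gcptRange {n : Vtx d} {I : PastingShape d} (f : Hom (stdGrid d n) I) (a : Fin d) :
    Set ℕ := Set.range (gcpt f a)

theorem boxDim_self (x : Vtx d) : boxDim x x = 0 := by simp [boxDim]

theorem boxDim_face_le {x' y' x y : Vtx d} (h : IsFaceOf x' y' x y) :
    boxDim x' y' ≤ boxDim x y := by
  apply Finset.card_le_card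
  intro a ha
  simp only [Finset.mem_filter, Finset.mem_univ, true_and] at ha ⊢
  have h1 := (h.1 a).1
  have h2 := (h.1 a).2
  omega

theorem boxDim_join_le {x y x' y' : Vtx d} (h : Adjacent x y x' y') :
    boxDim x y' ≤ boxDim x y := by
  apply Finset.card_le_card
  intro a ha
  simp only [Finset.mem_filter, Finset.mem_univ, true_and] at ha ⊢
  have := h.2.2.1 a
  omega

/-- The `k`-truncation of a pasting shape: its boxes of dimension `≤ k`. -/
def PastingShape.trunc (k : ℕ) (I : PastingShape d) : PastingShape d where
  boxes := {p | p ∈ I.boxes ∧ boxDim p.1 p.2 ≤ k}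
  isBox' p hp := I.isBox' p hp.1
  face_closed' p hp x' y' hf :=
    ⟨I.face_closed' p hp.1 x' y' hf, le_trans (boxDim_face_le hf) hp.2⟩
  join_closed' x y x' y' h h' hadj :=
    ⟨I.join_closed' x y x' y' h.1 h'.1 hadj, le_trans (boxDim_join_le hadj) h.2⟩

/-- Intersection of pasting shapes. -/
def PastingShape.inter (I J : PastingShape d) : PastingShape d where
  boxes := I.boxes ∩ J.boxes
  isBox' p hp := I.isBox' p hp.1
  face_closed' p hp x' y' hf :=
    ⟨I.face_closed' p hp.1 _ _ hf, J.face_closed' p hp.2 _ _ hf⟩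
  join_closed' x y x' y' h h' ha :=
    ⟨I.join_closed' _ _ _ _ h.1 h'.1 ha, J.join_closed' _ _ _ _ h.2 h'.2 ha⟩

theorem unitVtx_mem_trunc {k : ℕ} {n : Vtx d} {a : Fin d} {i : ℕ} (h : i ≤ n a) :
    unitVtx a i ∈ ((stdGrid d n).trunc k).vertices :=
  ⟨unitVtx_mem h, by simp [boxDim]⟩

/-- The components of a map out of a truncated standard grid. -/
def tcpt {k : ℕ} {n : Vtx d} {I : PastingShape d} (f : Hom ((stdGrid d n).trunc k) I)
    (a : Fin d) (i : Fin (n a + 1)) : ℕ :=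
  (f.toFun ⟨unitVtx a i, unitVtx_mem_trunc (Nat.lt_succ_iff.mp i.isLt)⟩ : Vtx d) a

/-- The image of the `a`-th component of a map out of a truncated standard grid. -/
def tcptRange {k : ℕ} {n : Vtx d} {I : PastingShape d} (f : Hom ((stdGrid d n).trunc k) I)
    (a : Fin d) : Set ℕ := Set.range (tcpt f a)

/-- The closure of a set of boxes under faces and joins. -/
inductive BoxClosure (S : Set (Vtx d × Vtx d)) : Vtx d × Vtx d → Prop
  | base {p} : p ∈ S → BoxClosure S p
  | face {p : Vtx d × Vtx d} {x' y' : Vtx d} :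
      BoxClosure S p → IsFaceOf x' y' p.1 p.2 → BoxClosure S (x', y')
  | join {x y x' y' : Vtx d} : BoxClosure S (x, y) → BoxClosure S (x', y') →
      Adjacent x y x' y' → BoxClosure S (x, y')

/-- The smallest pasting shape containing a given set of boxes. -/
def closureShape (S : Set (Vtx d × Vtx d)) (hS : ∀ p ∈ S, IsBoxPair p.1 p.2) :
    PastingShape d where
  boxes := {p | BoxClosure S p}
  isBox' := by
    intro p hp
    induction hp with
    | base h => exact hS _ h
    | face _ hf _ => exact hf.2
    | join _ _ hadj _ _ => exact hadj.boxPair_join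
  face_closed' p hp x' y' hf := BoxClosure.face hp hf
  join_closed' x y x' y' h h' ha := BoxClosure.join h h' ha

/-- The union of two pasting shapes: the smallest pasting shape containing both. -/
def union (I J : PastingShape d) : PastingShape d :=
  closureShape (I.boxes ∪ J.boxes) (by
    rintro p (h | h)
    · exact I.isBox' p h
    · exact J.isBox' p h)

/-- The union of a family of pasting shapes. -/
def iUnionShape {ι : Type} (f : ι → PastingShape d) : PastingShape d :=
  closureShape (⋃ i, (f i).boxes) (by
    intro p hp
    rcases Set.mem_iUnion.mp hp with ⟨i, hi⟩
    exact (f i).isBox' p hi)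

/-- The union of a set of pasting shapes. -/
def sUnionShape (S : Set (PastingShape d)) : PastingShape d :=
  closureShape (⋃ I ∈ S, I.boxes) (by
    intro p hp
    rcases Set.mem_iUnion₂.mp hp with ⟨I, _, hI⟩
    exact I.isBox' p hI)

theorem grid_apply {n : Vtx d} {I : PastingShape d} (f : Hom (stdGrid d n) I)
    (x : (stdGrid d n).vertices) (a : Fin d) :
    (f.toFun x : Vtx d) a =
      gcpt f a ⟨(x : Vtx d) a, Nat.lt_succ_of_le (mem_stdGrid_vertices.mp x.2 a)⟩ := by
  have hmem : unitVtx a ((x : Vtx d) a) ∈ (stdGrid d n).vertices :=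
    unitVtx_mem (mem_stdGrid_vertices.mp x.2 a)
  have hbox : (unitVtx a ((x : Vtx d) a), (x : Vtx d)) ∈ (stdGrid d n).boxes := by
    intro b
    constructor
    · show unitVtx a ((x : Vtx d) a) b ≤ (x : Vtx d) b
      unfold unitVtx
      by_cases hb : b = a
      · subst hb; simp
      · simp [hb]
    · exact mem_stdGrid_vertices.mp x.2 b
  have hdeg := f.map_deg ⟨unitVtx a ((x : Vtx d) a), hmem⟩ x hbox a
    (by unfold unitVtx; simp)
  exact hdeg.symm

theorem gcpt_mono {n : Vtx d} {I : PastingShape d} (f : Hom (stdGrid d n) I) (a : Fin d) :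
    Monotone (gcpt f a) := by
  intro i j hij
  have hbox : (unitVtx a (i : ℕ), unitVtx a (j : ℕ)) ∈ (stdGrid d n).boxes := by
    intro b
    unfold unitVtx
    by_cases hb : b = a
    · subst hb
      simp only [if_pos rfl]
      exact ⟨hij, Nat.lt_succ_iff.mp j.isLt⟩
    · simp [hb]
  have hmem := f.map_box ⟨unitVtx a (i : ℕ), unitVtx_mem (Nat.lt_succ_iff.mp i.isLt)⟩
    ⟨unitVtx a (j : ℕ), unitVtx_mem (Nat.lt_succ_iff.mp j.isLt)⟩ hbox
  exact (I.isBox' _ hmem) a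

theorem vApp_coord {n : Vtx d} {I : PastingShape d} (f : Hom (stdGrid d n) I) {x : Vtx d}
    (hx : x ∈ (stdGrid d n).vertices) (a : Fin d) :
    f.vApp x a = gcpt f a ⟨x a, Nat.lt_succ_of_le (mem_stdGrid_vertices.mp hx a)⟩ := by
  rw [Hom.vApp, dif_pos hx]
  exact grid_apply f ⟨x, hx⟩ a

theorem vApp_coord_eq {n : Vtx d} {I : PastingShape d} (f : Hom (stdGrid d n) I)
    {x x' : Vtx d} (hx : x ∈ (stdGrid d n).vertices) (hx' : x' ∈ (stdGrid d n).vertices)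
    (a : Fin d) (h : x a = x' a) : f.vApp x a = f.vApp x' a := by
  rw [vApp_coord f hx a, vApp_coord f hx' a]
  exact congrArg (gcpt f a) (Fin.ext h)

theorem vApp_coord_le {n : Vtx d} {I : PastingShape d} (f : Hom (stdGrid d n) I)
    {x x' : Vtx d} (hx : x ∈ (stdGrid d n).vertices) (hx' : x' ∈ (stdGrid d n).vertices)
    (a : Fin d) (h : x a ≤ x' a) : f.vApp x a ≤ f.vApp x' a := by
  rw [vApp_coord f hx a, vApp_coord f hx' a]
  exact gcpt_mono f a h

/-- `E` is a `k`-entire subshape of `I` with bounding box `(α, ω)`. -/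
structure IsEntireWith (I E : PastingShape d) (k : ℕ) (α ω : Vtx d) : Prop where
  sub : E ≤ I
  boxPair : IsBoxPair α ω
  dim_eq : boxDim α ω = k
  faces_mem : ∀ x' y' : Vtx d, IsFaceOf x' y' α ω → boxDim x' y' < k → (x', y') ∈ I.boxes
  mem_iff : ∀ p ∈ I.boxes, (p ∈ E.boxes ↔ ∀ a, α a ≤ p.1 a ∧ p.2 a ≤ ω a)

/-- `E` is a `k`-entire subshape of `I`. -/
def IsEntire (I E : PastingShape d) (k : ℕ) : Prop := ∃ α ω, IsEntireWith I E k α ω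

/-- `E` is a closed `k`-entire subshape of `I`: its bounding box belongs to `I`. -/
def IsClosedEntire (I E : PastingShape d) (k : ℕ) : Prop :=
  ∃ α ω, IsEntireWith I E k α ω ∧ (α, ω) ∈ I.boxes

/-- `E` is open (as a `k`-dimensional entire subshape): all its `k`-boxes are degenerate. -/
def IsOpenShape (E : PastingShape d) (k : ℕ) : Prop := ∀ p ∈ E.boxes, boxDim p.1 p.2 < k

/-- `V` is a `k`-vertebra of `I`: a minimal `k`-entire subshape. -/
def IsVertebra (I V : PastingShape d) (k : ℕ) : Prop :=
  IsEntire I V k ∧ ∀ E : PastingShape d, E ≤ V → IsEntire I E k → E = V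

/-- `V` is a closed `k`-vertebra of `I`. -/
def IsClosedVertebra (I V : PastingShape d) (k : ℕ) : Prop :=
  IsVertebra I V k ∧ IsClosedEntire I V k

/-- `V` is an open vertebra (= open `d`-vertebra) of `I`. -/
def IsOpenVertebra (I V : PastingShape d) : Prop := IsVertebra I V d ∧ IsOpenShape V d

/-- A `d`-shaping map: injective, and every non-degenerate `d`-box of the target is the
image of a non-degenerate `d`-box of the source. -/
def IsShaping {I J : PastingShape d} (f : Hom I J) : Prop :=
  Function.Injective f.toFun ∧
  ∀ p ∈ J.boxes, boxDim p.1 p.2 = d →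
    ∃ q, ∃ _ : q ∈ I.boxes, boxDim q.1 q.2 = d ∧ (f.vApp q.1, f.vApp q.2) = p

/-- `f` witnesses `A` to be an open grid. -/
def WitnessesOpenGrid {A : PastingShape d} {n : Vtx d}
    (f : Hom ((stdGrid d n).trunc (d - 1)) A) : Prop :=
  (∀ a, n a ≠ 0) ∧ IsShaping f ∧
  ∀ p ∈ A.boxes, boxDim p.1 p.2 ≤ d - 1 →
    (∀ a, p.1 a ≤ tcpt f a ⟨n a, Nat.lt_succ_self _⟩ ∧
      p.2 a ≤ tcpt f a ⟨n a, Nat.lt_succ_self _⟩) ∧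
    ∃ b, p.1 b = p.2 b ∧ p.1 b ∈ tcptRange f b

/-- `f` witnesses `A` to be a closed grid. -/
def WitnessesClosedGrid {A : PastingShape d} {n : Vtx d} (f : Hom (stdGrid d n) A) : Prop :=
  (∀ a, n a ≠ 0) ∧ IsShaping f ∧
  ∀ p ∈ A.boxes, boxDim p.1 p.2 ≤ d - 1 →
    (∀ a, p.1 a ≤ gcpt f a ⟨n a, Nat.lt_succ_self _⟩ ∧
      p.2 a ≤ gcpt f a ⟨n a, Nat.lt_succ_self _⟩) ∧
    ∃ b, p.1 b = p.2 b ∧ p.1 b ∈ gcptRange f b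

def IsOpenGrid (A : PastingShape d) : Prop :=
  ∃ (n : Vtx d) (f : Hom ((stdGrid d n).trunc (d - 1)) A), WitnessesOpenGrid f

def IsClosedGrid (A : PastingShape d) : Prop :=
  ∃ (n : Vtx d) (f : Hom (stdGrid d n) A), WitnessesClosedGrid f

def IsGrid (A : PastingShape d) : Prop := IsOpenGrid A ∨ IsClosedGrid A

/-- `A` is a grid with corners `c`. -/
def IsGridWithCorners (A : PastingShape d) (c : Fin d → ℕ × ℕ) : Prop :=
  (∃ (n : Vtx d) (f : Hom ((stdGrid d n).trunc (d - 1)) A), WitnessesOpenGrid f ∧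
    ∀ a, tcpt f a ⟨0, Nat.succ_pos _⟩ = (c a).1 ∧
      tcpt f a ⟨n a, Nat.lt_succ_self _⟩ = (c a).2) ∨
  (∃ (n : Vtx d) (f : Hom (stdGrid d n) A), WitnessesClosedGrid f ∧
    ∀ a, gcpt f a ⟨0, Nat.succ_pos _⟩ = (c a).1 ∧
      gcpt f a ⟨n a, Nat.lt_succ_self _⟩ = (c a).2)

/-- `A` is a cell: a grid on the tuple `(1, …, 1)`. -/
def IsCell (A : PastingShape d) : Prop :=
  (∃ f : Hom ((stdGrid d (fun _ => 1)).trunc (d - 1)) A, WitnessesOpenGrid f) ∨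
  (∃ f : Hom (stdGrid d (fun _ => 1)) A, WitnessesClosedGrid f)

/-- The boundary of a shape with corners `c`: those boxes degenerate at some index at a
corner coordinate. -/
def boundary (A : PastingShape d) (c : Fin d → ℕ × ℕ) : PastingShape d where
  boxes := {p | p ∈ A.boxes ∧ ∃ a, p.1 a = p.2 a ∧ (p.1 a = (c a).1 ∨ p.1 a = (c a).2)}
  isBox' p hp := A.isBox' p hp.1
  face_closed' := by
    rintro ⟨x, y⟩ ⟨hA, a, he, hc⟩ x' y' hf
    refine ⟨A.face_closed' _ hA x' y' hf, a, ?_, ?_⟩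
    · show x' a = y' a
      have h1 : x' a = x a ∨ x' a = y a := (hf.1 a).1
      have h2 : y' a = x a ∨ y' a = y a := (hf.1 a).2
      have he' : x a = y a := he
      omega
    · show x' a = (c a).1 ∨ x' a = (c a).2
      have h1 : x' a = x a ∨ x' a = y a := (hf.1 a).1
      have he' : x a = y a := he
      have hc' : x a = (c a).1 ∨ x a = (c a).2 := hc
      omega
  join_closed' := by
    rintro x y x' y' ⟨hA, a, he, hc⟩ ⟨hA', _⟩ hadj
    refine ⟨A.join_closed' _ _ _ _ hA hA' hadj, a, ?_, hc⟩
    show x a = y' a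
    have he' : x a = y a := he
    have := hadj.2.2.1 a
    omega

/-- Admittable pasting shapes (with the corners of the initial grid recorded):
built from a grid by successively glueing grids along open vertebrae. -/
inductive IsAdmittableC : PastingShape d → (Fin d → ℕ × ℕ) → Prop
  | grid {A : PastingShape d} {c : Fin d → ℕ × ℕ} :
      IsGridWithCorners A c → IsAdmittableC A c
  | step {K A : PastingShape d} {c cA : Fin d → ℕ × ℕ} :
      IsAdmittableC K c → IsGridWithCorners A cA →
      PastingShape.inter K A = boundary A cA →
      IsOpenVertebra K (boundary A cA) →
      IsAdmittableC (union K A) c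

/-- Admittable pasting shapes. -/
def IsAdmittable (I : PastingShape d) : Prop := ∃ c, IsAdmittableC I c

/-- `(K, J)` is a division pair for `I`, where `J` has corners `cJ`. -/
structure IsDivisionPair (I K J : PastingShape d) (cJ : Fin d → ℕ × ℕ) : Prop where
  admI : IsAdmittable I
  admK : IsAdmittable K
  admJ : IsAdmittableC J cJ
  subK : K ≤ I
  subJ : J ≤ I
  inter_eq : PastingShape.inter K J = boundary J cJ
  openVert : IsOpenVertebra K (boundary J cJ)
  union_eq : I = union K J

/-- `(A, {J_i})` is a decomposition of `I`. -/
structure IsDecomposition (I A : PastingShape d) {m : ℕ} (J : Fin m → PastingShape d)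
    (cJ : Fin m → Fin d → ℕ × ℕ) : Prop where
  openGrid : IsOpenGrid A
  subA : A ≤ I
  subJ : ∀ i, J i ≤ I
  admJ : ∀ i, IsAdmittableC (J i) (cJ i)
  inter_eq : ∀ i, PastingShape.inter A (J i) = boundary (J i) (cJ i)
  openVert : ∀ i, IsOpenVertebra A (boundary (J i) (cJ i))
  distinct : ∀ i j, boundary (J i) (cJ i) = boundary (J j) (cJ j) → i = j
  union_eq : I = union A (iUnionShape J)

/-- Heights of admittable pasting shapes. -/
inductive HasHeight : PastingShape d → ℕ → Prop
  | cell {I : PastingShape d} : IsCell I → HasHeight I 0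
  | step {I A : PastingShape d} {m : ℕ} {J : Fin m → PastingShape d}
      {cJ : Fin m → Fin d → ℕ × ℕ} {h : ℕ} :
      IsDecomposition I A J cJ → (∀ i, HasHeight (J i) h) → HasHeight I (h + 1)

/-- Expansion of a point of `ℕ^k` to a point of `ℕ^d` along an embedding `e`, using the
constants `c` outside the image of `e`. -/
noncomputable def expandVtx {k : ℕ} (e : Fin k ↪ Fin d) (c : Vtx d) (x : Vtx k) : Vtx d :=
  fun b => if h : ∃ i, e i = b then x h.choose else c b

theorem expandVtx_apply {k : ℕ} (e : Fin k ↪ Fin d) (c : Vtx d) (x : Vtx k) (i : Fin k) :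
    expandVtx e c x (e i) = x i := by
  have h : ∃ j, e j = e i := ⟨i, rfl⟩
  rw [expandVtx, dif_pos h]
  exact congrArg x (e.injective h.choose_spec)

theorem expandVtx_not {k : ℕ} (e : Fin k ↪ Fin d) (c : Vtx d) (x : Vtx k) {b : Fin d}
    (h : ¬∃ i, e i = b) : expandVtx e c x b = c b := dif_neg h

/-- A pasting shape contained in a hyperplane, viewed as a lower-dimensional
pasting shape: `e` enumerates the active directions and `c` records the constants in the
remaining directions. -/
noncomputable def restrictShape {k : ℕ} (e : Fin k ↪ Fin d) (c : Vtx d)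
    (E : PastingShape d) : PastingShape k where
  boxes := {p | (expandVtx e c p.1, expandVtx e c p.2) ∈ E.boxes}
  isBox' := by
    intro p hp i
    have h := E.isBox' _ hp (e i)
    simp only [expandVtx_apply] at h
    exact h
  face_closed' := by
    intro p hp x' y' hface
    refine E.face_closed' _ hp (expandVtx e c x') (expandVtx e c y') ⟨?_, ?_⟩
    · intro b
      by_cases hb : ∃ i, e i = b
      · obtain ⟨i, rfl⟩ := hb
        simp only [expandVtx_apply]
        exact hface.1 i
      · simp [expandVtx_not e c x' hb, expandVtx_not e c y' hb,
          expandVtx_not e c p.1 hb, expandVtx_not e c p.2 hb]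
    · intro b
      by_cases hb : ∃ i, e i = b
      · obtain ⟨i, rfl⟩ := hb
        simp only [expandVtx_apply]
        exact hface.2 i
      · simp [expandVtx_not e c x' hb, expandVtx_not e c y' hb]
  join_closed' := by
    intro x y x' y' h h' hadj
    refine E.join_closed' (expandVtx e c x) (expandVtx e c y) (expandVtx e c x')
      (expandVtx e c y') h h' ⟨?_, ?_, ?_, ?_⟩
    · intro b
      by_cases hb : ∃ i, e i = b
      · obtain ⟨i, rfl⟩ := hb
        simp only [expandVtx_apply]
        exact hadj.1 i
      · simp [expandVtx_not e c x hb, expandVtx_not e c y hb]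
    · intro b
      by_cases hb : ∃ i, e i = b
      · obtain ⟨i, rfl⟩ := hb
        simp only [expandVtx_apply]
        exact hadj.2.1 i
      · simp [expandVtx_not e c x' hb, expandVtx_not e c y' hb]
    · intro b
      by_cases hb : ∃ i, e i = b
      · obtain ⟨i, rfl⟩ := hb
        simp only [expandVtx_apply]
        exact hadj.2.2.1 i
      · left
        rw [expandVtx_not e c x hb, expandVtx_not e c x' hb, expandVtx_not e c y hb,
          expandVtx_not e c y' hb]
        exact ⟨rfl, rfl⟩
    · intro b b' hb hb'
      have hbr : ∃ i, e i = b := by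
        by_contra hcon
        exact hb ⟨by rw [expandVtx_not e c x hcon, expandVtx_not e c x' hcon],
          by rw [expandVtx_not e c y hcon, expandVtx_not e c y' hcon]⟩
      have hbr' : ∃ i, e i = b' := by
        by_contra hcon
        exact hb' ⟨by rw [expandVtx_not e c x hcon, expandVtx_not e c x' hcon],
          by rw [expandVtx_not e c y hcon, expandVtx_not e c y' hcon]⟩
      obtain ⟨i, rfl⟩ := hbr
      obtain ⟨j, rfl⟩ := hbr'
      have hi : ¬(x i = x' i ∧ y i = y' i) := fun hcon => hb
        ⟨by rw [expandVtx_apply, expandVtx_apply, hcon.1],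
         by rw [expandVtx_apply, expandVtx_apply, hcon.2]⟩
      have hj : ¬(x j = x' j ∧ y j = y' j) := fun hcon => hb'
        ⟨by rw [expandVtx_apply, expandVtx_apply, hcon.1],
         by rw [expandVtx_apply, expandVtx_apply, hcon.2]⟩
      exact congrArg e (hadj.2.2.2 i j hi hj)

/-- A composable pasting shape: closed admittable, and all of its closed `k`-entire
subshapes for `k < d`, viewed as `k`-dimensional pasting shapes, are admittable. -/
def IsComposable (I : PastingShape d) : Prop :=
  IsAdmittable I ∧ IsClosedEntire I I d ∧
  ∀ k, k < d → ∀ (E : PastingShape d) (α ω : Vtx d), IsEntireWith I E k α ω →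
    (α, ω) ∈ I.boxes → ∀ e : Fin k ↪ Fin d, Set.range ⇑e = {a | α a ≠ ω a} →
    IsAdmittable (restrictShape e α E)

/-- A locally composable pasting shape: finitely many boxes and all of its closed
`k`-entire subshapes for `1 ≤ k ≤ d`, viewed as `k`-dimensional pasting shapes, are
admittable. -/
def IsLocallyComposable (I : PastingShape d) : Prop :=
  I.boxes.Finite ∧
  ∀ k, 1 ≤ k → k ≤ d → ∀ (E : PastingShape d) (α ω : Vtx d), IsEntireWith I E k α ω →
    (α, ω) ∈ I.boxes → ∀ e : Fin k ↪ Fin d, Set.range ⇑e = {a | α a ≠ ω a} →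
    IsAdmittable (restrictShape e α E)

/-- The map of standard grids induced by a tuple of monotone maps, i.e. by a morphism of
`Δ^{×d}`. -/
def gridOfMono {m n : Vtx d} (φ : ∀ a, Fin (m a + 1) →o Fin (n a + 1)) :
    Hom (stdGrid d m) (stdGrid d n) where
  toFun x := ⟨fun a => (φ a ⟨(x : Vtx d) a, Nat.lt_succ_of_le (mem_stdGrid_vertices.mp x.2 a)⟩ : Fin (n a + 1)),
    mem_stdGrid_vertices.mpr fun a => Nat.lt_succ_iff.mp (φ a _).isLt⟩
  map_box := by
    intro x y h a
    constructor
    · exact (φ a).monotone (by exact (h a).1)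
    · exact Nat.lt_succ_iff.mp (φ a _).isLt
  map_deg := by
    intro x y h a ha
    show ((φ a _ : Fin (n a + 1)) : ℕ) = ((φ a _ : Fin (n a + 1)) : ℕ)
    exact congrArg _ (congrArg (φ a) (Fin.ext ha))

/-- A morphism of nerves of pasting shapes: a natural transformation of `d`-uple
simplicial sets. -/
structure NerveHom (I J : PastingShape d) where
  app : ∀ n : Vtx d, Hom (stdGrid d n) I → Hom (stdGrid d n) J
  naturality : ∀ (m n : Vtx d) (φ : ∀ a, Fin (m a + 1) →o Fin (n a + 1))
      (σ : Hom (stdGrid d n) I),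
    app m (σ.comp (gridOfMono φ)) = (app n σ).comp (gridOfMono φ)

/-- The morphism of nerves induced by a map of pasting shapes. -/
def nerveMap {I J : PastingShape d} (g : Hom I J) : NerveHom I J where
  app n σ := g.comp σ
  naturality m n φ σ := rfl

/-- The simplex `σ` of the nerve is of dimension `≤ k`. -/
def NerveDimLE {I : PastingShape d} {n : Vtx d} (σ : Hom (stdGrid d n) I) (k : ℕ) : Prop :=
  ∃ (m : Vtx d) (φ : ∀ a, Fin (n a + 1) →o Fin (m a + 1)) (τ : Hom (stdGrid d m) I),
    (Finset.univ.filter fun a => m a ≠ 0).card ≤ k ∧ τ.comp (gridOfMono φ) = σ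

/-- The simplex `σ` of the nerve of `I` lands in the subshape `S`. -/
def LandsIn {I : PastingShape d} {n : Vtx d} (σ : Hom (stdGrid d n) I)
    (S : PastingShape d) : Prop :=
  ∀ p ∈ (stdGrid d n).boxes, (σ.vApp p.1, σ.vApp p.2) ∈ S.boxes

/-- The image subshape of a map of pasting shapes. -/
noncomputable def Hom.imageShape {I J : PastingShape d} (f : Hom I J) : PastingShape d :=
  closureShape {q | ∃ p ∈ I.boxes, q = (f.vApp p.1, f.vApp p.2)}
    (by rintro q ⟨p, hp, rfl⟩; exact J.isBox' _ (f.vApp_box hp))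

/-- The `k`-dimensional hyperplane determined by the degenerate directions `D` and the
constants `c`. -/
def hyperplane (D : Finset (Fin d)) (c : Vtx d) : PastingShape d where
  boxes := {p | IsBoxPair p.1 p.2 ∧ ∀ a ∈ D, p.1 a = c a ∧ p.2 a = c a}
  isBox' p hp := hp.1
  face_closed' := by
    rintro ⟨x, y⟩ ⟨hb, hD⟩ x' y' ⟨hf, hbp⟩
    refine ⟨hbp, fun a ha => ?_⟩
    have h1 : x' a = x a ∨ x' a = y a := (hf a).1
    have h2 : y' a = x a ∨ y' a = y a := (hf a).2
    have h3 : x a = c a ∧ y a = c a := hD a ha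
    constructor
    · show x' a = c a
      omega
    · show y' a = c a
      omega
  join_closed' := by
    intro x y x' y' h h' hadj
    refine ⟨hadj.boxPair_join, fun a ha => ?_⟩
    have h3 : x a = c a ∧ y a = c a := h.2 a ha
    have h4 : x' a = c a ∧ y' a = c a := h'.2 a ha
    exact ⟨h3.1, h4.2⟩

/-- The inert inclusion of the `i`-th unit interval in direction `a`. -/
def edgeHom (n : Vtx d) (a : Fin d) (i : ℕ) (hi : i + 1 ≤ n a) :
    Hom (stdGrid d (Function.update n a 1)) (stdGrid d n) where
  toFun x := ⟨fun b => if b = a then (x : Vtx d) b + i else (x : Vtx d) b, by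
    rw [mem_stdGrid_vertices]
    intro b
    have hb := mem_stdGrid_vertices.mp x.2 b
    rw [Function.update_apply] at hb
    by_cases h : b = a
    · rw [if_pos h] at hb ⊢
      subst h
      omega
    · rw [if_neg h] at hb ⊢
      exact hb⟩
  map_box := by
    intro x y hxy b
    have h1 : (x : Vtx d) b ≤ (y : Vtx d) b := (hxy b).1
    have h2 : (y : Vtx d) b ≤ Function.update n a 1 b := (hxy b).2
    rw [Function.update_apply] at h2
    show (if b = a then (x : Vtx d) b + i else (x : Vtx d) b) ≤
        (if b = a then (y : Vtx d) b + i else (y : Vtx d) b) ∧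
      (if b = a then (y : Vtx d) b + i else (y : Vtx d) b) ≤ n b
    by_cases h : b = a
    · subst h
      simp at h2 ⊢
      omega
    · simp only [if_neg h] at h2 ⊢
      exact ⟨h1, h2⟩
  map_deg := by
    intro x y hxy b hb
    show (if b = a then (x : Vtx d) b + i else (x : Vtx d) b) =
      (if b = a then (y : Vtx d) b + i else (y : Vtx d) b)
    by_cases h : b = a
    · simp only [if_pos h, hb]
    · simp only [if_neg h, hb]

/-- The inclusion of the vertex `{e}` of `[1]` in direction `a`. -/
def capHom (n : Vtx d) (a : Fin d) (e : ℕ) (he : e ≤ 1) :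
    Hom (stdGrid d (Function.update n a 0)) (stdGrid d (Function.update n a 1)) where
  toFun x := ⟨fun b => if b = a then e else (x : Vtx d) b, by
    rw [mem_stdGrid_vertices]
    intro b
    have hb := mem_stdGrid_vertices.mp x.2 b
    rw [Function.update_apply] at hb
    rw [Function.update_apply]
    by_cases h : b = a
    · rw [if_pos h, if_pos h]
      exact he
    · rw [if_neg h, if_neg h]
      rw [if_neg h] at hb
      exact hb⟩
  map_box := by
    intro x y hxy b
    have h1 : (x : Vtx d) b ≤ (y : Vtx d) b := (hxy b).1
    have h2 : (y : Vtx d) b ≤ Function.update n a 0 b := (hxy b).2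
    rw [Function.update_apply] at h2
    show (if b = a then e else (x : Vtx d) b) ≤ (if b = a then e else (y : Vtx d) b) ∧
      (if b = a then e else (y : Vtx d) b) ≤ Function.update n a 1 b
    rw [Function.update_apply]
    by_cases h : b = a
    · simp only [if_pos h] at h2 ⊢
      exact ⟨le_rfl, he⟩
    · simp only [if_neg h] at h2 ⊢
      exact ⟨h1, h2⟩
  map_deg := by
    intro x y hxy b hb
    show (if b = a then e else (x : Vtx d) b) = (if b = a then e else (y : Vtx d) b)
    by_cases h : b = a
    · simp only [if_pos h]
    · simp only [if_neg h, hb]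

/-- The set `Hom_I(⊔_a [n_a], ℕ)` of tuples of monotone maps all of whose associated
boxes belong to `I`. -/
def TupleHom (n : Vtx d) (I : PastingShape d) : Type :=
  {F : ∀ a : Fin d, Fin (n a + 1) → ℕ //
    (∀ a, Monotone (F a)) ∧
    ∀ x y : Vtx d, IsBoxPair x y →
      (∀ a, x a ∈ Set.range (F a) ∧ y a ∈ Set.range (F a)) → (x, y) ∈ I.boxes}

/-- The value `i_a(0)` for a map `i : □[1,…,1] → □[n]`. -/
def cpt0 {n : Vtx d} (i : Hom (stdGrid d (fun _ => 1)) (stdGrid d n)) (a : Fin d) : ℕ :=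
  gcpt i a ⟨0, Nat.succ_pos 1⟩

/-- The value `i_a(1)` for a map `i : □[1,…,1] → □[n]`. -/
def cpt1 {n : Vtx d} (i : Hom (stdGrid d (fun _ => 1)) (stdGrid d n)) (a : Fin d) : ℕ :=
  gcpt i a ⟨1, Nat.lt_succ_self 1⟩

theorem cpt0_le_cpt1 {n : Vtx d} (i : Hom (stdGrid d (fun _ => 1)) (stdGrid d n))
    (a : Fin d) : cpt0 i a ≤ cpt1 i a :=
  gcpt_mono i a (by exact Nat.zero_le 1)

theorem cpt0_lt_cpt1 {n : Vtx d} (i : Hom (stdGrid d (fun _ => 1)) (stdGrid d n))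
    (hi : Function.Injective i.toFun) (a : Fin d) : cpt0 i a < cpt1 i a := by
  rcases lt_or_eq_of_le (cpt0_le_cpt1 i a) with h | h
  · exact h
  exfalso
  have h0 : unitVtx (d := d) a 0 ∈ (stdGrid d (fun _ => 1)).vertices :=
    unitVtx_mem (Nat.zero_le 1)
  have h1 : unitVtx (d := d) a 1 ∈ (stdGrid d (fun _ => 1)).vertices :=
    unitVtx_mem (le_refl 1)
  have hbox : (unitVtx (d := d) a 0, unitVtx a 1) ∈ (stdGrid d (fun _ => 1)).boxes := by
    intro b
    show unitVtx a 0 b ≤ unitVtx a 1 b ∧ unitVtx a 1 b ≤ 1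
    unfold unitVtx
    by_cases hb : b = a <;> simp [hb]
  have hdeg : ∀ b, (i.toFun ⟨unitVtx a 0, h0⟩ : Vtx d) b = (i.toFun ⟨unitVtx a 1, h1⟩ : Vtx d) b := by
    intro b
    by_cases hb : b = a
    · subst hb
      exact h
    · exact i.map_deg _ _ hbox b (by unfold unitVtx; simp [hb])
  have := hi (Subtype.ext (funext hdeg))
  have hcon := congrFun (congrArg Subtype.val this) a
  unfold unitVtx at hcon
  simp at hcon

/-- The subshape `⊡[i] ⊂ □[n]` associated with an injective map `i : □[1,…,1] → □[n]`. -/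
def boxdot {n : Vtx d} (i : Hom (stdGrid d (fun _ => 1)) (stdGrid d n))
    (hi : Function.Injective i.toFun) : PastingShape d where
  boxes := {p | p ∈ (stdGrid d n).boxes ∧ ∃ a, p.2 a ≤ cpt0 i a ∨ cpt1 i a ≤ p.1 a}
  isBox' p hp := (stdGrid d n).isBox' p hp.1
  face_closed' := by
    intro p hp x' y' hf
    obtain ⟨hg, a, hc⟩ := hp
    refine ⟨(stdGrid d n).face_closed' _ hg x' y' hf, a, ?_⟩
    have hxy : p.1 a ≤ p.2 a := ((stdGrid d n).isBox' _ hg) a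
    have h1 : x' a = p.1 a ∨ x' a = p.2 a := (hf.1 a).1
    have h2 : y' a = p.1 a ∨ y' a = p.2 a := (hf.1 a).2
    show y' a ≤ cpt0 i a ∨ cpt1 i a ≤ x' a
    omega
  join_closed' := by
    intro x y x' y' h h' hadj
    obtain ⟨hg, a, hca0⟩ := h
    obtain ⟨hg', b, hcb0⟩ := h'
    have hca : y a ≤ cpt0 i a ∨ cpt1 i a ≤ x a := hca0
    have hcb : y' b ≤ cpt0 i b ∨ cpt1 i b ≤ x' b := hcb0
    refine ⟨(stdGrid d n).join_closed' _ _ _ _ hg hg' hadj, ?_⟩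
    show ∃ c, y' c ≤ cpt0 i c ∨ cpt1 i c ≤ x c
    rcases hca with hca | hca
    · rcases hcb with hcb | hcb
      · exact ⟨b, Or.inl hcb⟩
      · rcases hadj.2.2.1 b with ⟨e1, e2⟩ | ⟨l1, e2, l2⟩
        · exact ⟨b, Or.inr (by omega)⟩
        · rcases hadj.2.2.1 a with ⟨e1a, e2a⟩ | ⟨l1a, e2a, l2a⟩
          · exact ⟨a, Or.inl (by omega)⟩
          · have hab : a = b := hadj.2.2.2 a b (by omega) (by omega)
            subst hab
            have := cpt0_lt_cpt1 i hi a
            exfalso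
            omega
    · exact ⟨a, Or.inr hca⟩

/-- The subshape `M^σ_a[i] ⊂ □[n]`:  `σ = false` is the negative side, `σ = true` the
positive one. -/
def Mside {n : Vtx d} (i : Hom (stdGrid d (fun _ => 1)) (stdGrid d n)) (a : Fin d)
    (σ : Bool) : PastingShape d where
  boxes := {p | p ∈ (stdGrid d n).boxes ∧
    if σ then cpt1 i a ≤ p.1 a ∧ cpt1 i a ≤ p.2 a else p.1 a ≤ cpt0 i a ∧ p.2 a ≤ cpt0 i a}
  isBox' p hp := (stdGrid d n).isBox' p hp.1
  face_closed' := by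
    intro p hp x' y' hf
    obtain ⟨hg, hc0⟩ := hp
    refine ⟨(stdGrid d n).face_closed' _ hg x' y' hf, ?_⟩
    have h1 : x' a = p.1 a ∨ x' a = p.2 a := (hf.1 a).1
    have h2 : y' a = p.1 a ∨ y' a = p.2 a := (hf.1 a).2
    cases σ
    · have hc : p.1 a ≤ cpt0 i a ∧ p.2 a ≤ cpt0 i a := hc0
      show x' a ≤ cpt0 i a ∧ y' a ≤ cpt0 i a
      omega
    · have hc : cpt1 i a ≤ p.1 a ∧ cpt1 i a ≤ p.2 a := hc0
      show cpt1 i a ≤ x' a ∧ cpt1 i a ≤ y' a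
      omega
  join_closed' := by
    intro x y x' y' h h' hadj
    obtain ⟨hg, hc0⟩ := h
    obtain ⟨hg', hc0'⟩ := h'
    refine ⟨(stdGrid d n).join_closed' _ _ _ _ hg hg' hadj, ?_⟩
    cases σ
    · have hc : x a ≤ cpt0 i a ∧ y a ≤ cpt0 i a := hc0
      have hc' : x' a ≤ cpt0 i a ∧ y' a ≤ cpt0 i a := hc0'
      show x a ≤ cpt0 i a ∧ y' a ≤ cpt0 i a
      omega
    · have hc : cpt1 i a ≤ x a ∧ cpt1 i a ≤ y a := hc0
      have hc' : cpt1 i a ≤ x' a ∧ cpt1 i a ≤ y' a := hc0'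
      show cpt1 i a ≤ x a ∧ cpt1 i a ≤ y' a
      omega

/-- The subshape `A[i] ⊂ □[n]`: the largest subshape whose vertices lie between the
corners of `i`. -/
def innerShape {n : Vtx d} (i : Hom (stdGrid d (fun _ => 1)) (stdGrid d n)) :
    PastingShape d where
  boxes := {p | p ∈ (stdGrid d n).boxes ∧ ∀ a, cpt0 i a ≤ p.1 a ∧ p.2 a ≤ cpt1 i a}
  isBox' p hp := (stdGrid d n).isBox' p hp.1
  face_closed' := by
    intro p hp x' y' hf
    obtain ⟨hg, hc⟩ := hp
    refine ⟨(stdGrid d n).face_closed' _ hg x' y' hf, fun a => ?_⟩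
    have h1 : x' a = p.1 a ∨ x' a = p.2 a := (hf.1 a).1
    have h2 : y' a = p.1 a ∨ y' a = p.2 a := (hf.1 a).2
    have hc' : cpt0 i a ≤ p.1 a ∧ p.2 a ≤ cpt1 i a := hc a
    have hxy : p.1 a ≤ p.2 a := ((stdGrid d n).isBox' _ hg) a
    show cpt0 i a ≤ x' a ∧ y' a ≤ cpt1 i a
    omega
  join_closed' := by
    intro x y x' y' h h' hadj
    obtain ⟨hg, hc⟩ := h
    obtain ⟨hg', hc'⟩ := h'
    refine ⟨(stdGrid d n).join_closed' _ _ _ _ hg hg' hadj, fun a => ?_⟩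
    exact ⟨(hc a).1, (hc' a).2⟩

/-- The preimage of a subshape under a map out of a standard grid. -/
noncomputable def gridPreimage {n : Vtx d} {I : PastingShape d} (f : Hom (stdGrid d n) I)
    (T : PastingShape d) : PastingShape d where
  boxes := {p | p ∈ (stdGrid d n).boxes ∧ (f.vApp p.1, f.vApp p.2) ∈ T.boxes}
  isBox' p hp := (stdGrid d n).isBox' p hp.1
  face_closed' := by
    intro p hp x' y' hf
    obtain ⟨hg, hT⟩ := hp
    have hg' : (x', y') ∈ (stdGrid d n).boxes := (stdGrid d n).face_closed' _ hg x' y' hf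
    refine ⟨hg', ?_⟩
    have v1 : p.1 ∈ (stdGrid d n).vertices := fst_mem_vertices hg
    have v2 : p.2 ∈ (stdGrid d n).vertices := snd_mem_vertices hg
    have v1' : x' ∈ (stdGrid d n).vertices := fst_mem_vertices hg'
    have v2' : y' ∈ (stdGrid d n).vertices := snd_mem_vertices hg'
    refine T.face_closed' _ hT (f.vApp x') (f.vApp y') ⟨fun a => ⟨?_, ?_⟩, fun a => ?_⟩
    · rcases (hf.1 a).1 with h | h
      · exact Or.inl (vApp_coord_eq f v1' v1 a h)
      · exact Or.inr (vApp_coord_eq f v1' v2 a h)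
    · rcases (hf.1 a).2 with h | h
      · exact Or.inl (vApp_coord_eq f v2' v1 a h)
      · exact Or.inr (vApp_coord_eq f v2' v2 a h)
    · exact vApp_coord_le f v1' v2' a (hf.2 a)
  join_closed' := by
    intro x y x' y' h h' hadj
    obtain ⟨hg, hT⟩ := h
    obtain ⟨hg', hT'⟩ := h'
    have hgj : (x, y') ∈ (stdGrid d n).boxes := (stdGrid d n).join_closed' _ _ _ _ hg hg' hadj
    refine ⟨hgj, ?_⟩
    have vx : x ∈ (stdGrid d n).vertices := fst_mem_vertices hg
    have vy : y ∈ (stdGrid d n).vertices := snd_mem_vertices hg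
    have vx' : x' ∈ (stdGrid d n).vertices := fst_mem_vertices hg'
    have vy' : y' ∈ (stdGrid d n).vertices := snd_mem_vertices hg'
    show (f.vApp x, f.vApp y') ∈ T.boxes
    by_cases hsp : ∃ b, ¬(x b = x' b ∧ y b = y' b)
    · obtain ⟨b, hb⟩ := hsp
      rcases hadj.2.2.1 b with hcb | hcb
      · exact absurd hcb hb
      obtain ⟨l1, e2, l2⟩ := hcb
      by_cases h1 : f.vApp x b = f.vApp y b
      · have hxx' : f.vApp x = f.vApp x' := by
          funext a
          by_cases hab : a = b
          · subst hab
            rw [h1]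
            exact vApp_coord_eq f vy vx' a e2
          · rcases hadj.2.2.1 a with ⟨ea1, ea2⟩ | ⟨la1, ea, la2⟩
            · exact vApp_coord_eq f vx vx' a ea1
            · exact absurd (hadj.2.2.2 a b (by omega) (by omega)) hab
        rw [hxx']
        exact hT'
      · by_cases h2 : f.vApp x' b = f.vApp y' b
        · have hyy' : f.vApp y' = f.vApp y := by
            funext a
            by_cases hab : a = b
            · subst hab
              rw [← h2]
              exact (vApp_coord_eq f vy vx' a e2).symm
            · rcases hadj.2.2.1 a with ⟨ea1, ea2⟩ | ⟨la1, ea, la2⟩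
              · exact vApp_coord_eq f vy' vy a ea2.symm
              · exact absurd (hadj.2.2.2 a b (by omega) (by omega)) hab
          rw [hyy']
          exact hT
        · refine T.join_closed' (f.vApp x) (f.vApp y) (f.vApp x') (f.vApp y') hT hT'
            ⟨?_, ?_, ?_, ?_⟩
          · exact T.isBox' _ hT
          · exact T.isBox' _ hT'
          · intro a
            by_cases hab : a = b
            · subst hab
              right
              refine ⟨?_, vApp_coord_eq f vy vx' a e2, ?_⟩
              · exact lt_of_le_of_ne (vApp_coord_le f vx vy a (le_of_lt l1)) h1
              · exact lt_of_le_of_ne (vApp_coord_le f vx' vy' a (le_of_lt l2)) h2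
            · rcases hadj.2.2.1 a with ⟨ea1, ea2⟩ | ⟨la1, ea, la2⟩
              · exact Or.inl ⟨vApp_coord_eq f vx vx' a ea1, vApp_coord_eq f vy vy' a ea2⟩
              · exact absurd (hadj.2.2.2 a b (by omega) (by omega)) hab
          · intro a a' ha ha'
            have hasb : a = b := by
              by_contra hab
              rcases hadj.2.2.1 a with ⟨ea1, ea2⟩ | ⟨la1, ea, la2⟩
              · exact ha ⟨vApp_coord_eq f vx vx' a ea1, vApp_coord_eq f vy vy' a ea2⟩
              · exact hab (hadj.2.2.2 a b (by omega) (by omega))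
            have hasb' : a' = b := by
              by_contra hab
              rcases hadj.2.2.1 a' with ⟨ea1, ea2⟩ | ⟨la1, ea, la2⟩
              · exact ha' ⟨vApp_coord_eq f vx vx' a' ea1, vApp_coord_eq f vy vy' a' ea2⟩
              · exact hab (hadj.2.2.2 a' b (by omega) (by omega))
            rw [hasb, hasb']
    · push_neg at hsp
      have hy' : y' = y := funext fun b => ((hsp b).2).symm
      rw [hy']
      exact hT

/-- A map `g : □[n] → I` underlies a map of division pairs `(⊡[i], A[i]) → (K, J)`. -/
noncomputable def IsDivPairMap {n : Vtx d} {I : PastingShape d} (K J : PastingShape d)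
    (g : Hom (stdGrid d n) I) (i : Hom (stdGrid d (fun _ => 1)) (stdGrid d n))
    (hi : Function.Injective i.toFun) : Prop :=
  gridPreimage g J = innerShape i ∧
  union (gridPreimage g K) ((stdGrid d n).trunc (d - 1)) =
    union (boxdot i hi) ((stdGrid d n).trunc (d - 1))

/-- `F` is a `(K, J)`-fillable subshape of `I`. -/
noncomputable def IsFillable (I K J F : PastingShape d) : Prop :=
  ∃ hFI : F ≤ I,
    F.trunc (d - 1) = F ∨
    ∃ (n : Vtx d) (f : Hom (stdGrid d n) F), IsShaping f ∧
      ((∀ p ∈ (stdGrid d n).boxes, (f.vApp p.1, f.vApp p.2) ∈ K.boxes) ∨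
       ∃ (i : Hom (stdGrid d (fun _ => 1)) (stdGrid d n)) (hi : Function.Injective i.toFun),
         IsDivPairMap K J ((inclHom hFI).comp f) i hi)

theorem card_filter_le_of_forall_mem_not {k : ℕ} (hk : k ≤ d) {D : Finset (Fin d)}
    (hD : D.card = d - k) {P : Fin d → Prop} [DecidablePred P] (hP : ∀ a ∈ D, ¬P a) :
    (Finset.univ.filter P).card ≤ k := by
  have hsub : Finset.univ.filter P ⊆ Dᶜ := fun a ha => by
    rw [Finset.mem_compl]
    exact fun h => hP a h (Finset.mem_filter.mp ha).2
  have hle := Finset.card_le_card hsub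
  rw [Finset.card_compl, Fintype.card_fin] at hle
  omega

theorem exists_finset_eq_of_boxDim_le {k : ℕ} {x y : Vtx d} (h : boxDim x y ≤ k) :
    ∃ D : Finset (Fin d), D.card = d - k ∧ ∀ a ∈ D, x a = y a := by
  have hcard : d - k ≤ (Finset.univ.filter fun a => x a ≠ y a)ᶜ.card := by
    rw [Finset.card_compl, Fintype.card_fin]
    exact Nat.sub_le_sub_left h d
  obtain ⟨D, hsub, hD⟩ := Finset.exists_subset_card_eq hcard
  exact ⟨D, hD, fun a ha => by simpa using hsub ha⟩

theorem inter_hyperplane_le_trunc {k : ℕ} (hk : k ≤ d) (I : PastingShape d)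
    {D : Finset (Fin d)} (hD : D.card = d - k) (c : Vtx d) :
    PastingShape.inter I (hyperplane D c) ≤ I.trunc k := fun _ hp =>
  ⟨hp.1, card_filter_le_of_forall_mem_not hk hD fun a ha h =>
    h ((hp.2.2 a ha).1.trans (hp.2.2 a ha).2.symm)⟩

theorem sUnionShape_le {S : Set (PastingShape d)} {J : PastingShape d}
    (h : ∀ I ∈ S, I ≤ J) : sUnionShape S ≤ J := by
  intro p hp
  induction hp with
  | base hp =>
    obtain ⟨I, hI, hpI⟩ := Set.mem_iUnion₂.mp hp
    exact h I hI hpI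
  | face _ hf ih => exact J.face_closed' _ ih _ _ hf
  | join _ _ ha ih ih' => exact J.join_closed' _ _ _ _ ih ih' ha

theorem LandsIn.exists_hyperplane {I : PastingShape d} {n : Vtx d} {k : ℕ}
    {σ : Hom (stdGrid d n) I} (h : LandsIn σ (I.trunc k)) :
    ∃ (D : Finset (Fin d)) (c : Vtx d),
      D.card = d - k ∧ LandsIn σ (PastingShape.inter I (hyperplane D c)) := by
  have h0 : (0 : Vtx d) ∈ (stdGrid d n).vertices :=
    mem_stdGrid_vertices.mpr fun a => Nat.zero_le (n a)
  have hn : n ∈ (stdGrid d n).vertices := mem_stdGrid_vertices.mpr fun _ => le_rfl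
  obtain ⟨D, hD, heq⟩ := exists_finset_eq_of_boxDim_le
    (h (0, n) fun a => ⟨Nat.zero_le (n a), le_rfl⟩).2
  have hconst : ∀ x ∈ (stdGrid d n).vertices, ∀ a ∈ D, σ.vApp x a = σ.vApp 0 a := by
    intro x hx a ha
    refine le_antisymm ?_ (vApp_coord_le σ h0 hx a (Nat.zero_le _))
    exact (vApp_coord_le σ hx hn a (mem_stdGrid_vertices.mp hx a)).trans_eq (heq a ha).symm
  exact ⟨D, σ.vApp 0, hD, fun p hp => ⟨σ.vApp_box hp, I.isBox' _ (σ.vApp_box hp),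
    fun a ha => ⟨hconst _ (fst_mem_vertices hp) a ha, hconst _ (snd_mem_vertices hp) a ha⟩⟩⟩

theorem nerveDimLE_of_landsIn_hyperplane {I : PastingShape d} {n : Vtx d} {k : ℕ}
    (hk : k ≤ d) {σ : Hom (stdGrid d n) I} {D : Finset (Fin d)} {c : Vtx d}
    (hD : D.card = d - k) (h : LandsIn σ (PastingShape.inter I (hyperplane D c))) :
    NerveDimLE σ k := by
  let m : Vtx d := fun a => if a ∈ D then 0 else n a
  have hmn : ∀ a, m a ≤ n a := fun a => by
    dsimp only [m]
    split_ifs <;> omega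
  let φ : ∀ a, Fin (n a + 1) →o Fin (m a + 1) := fun a =>
    ⟨fun i => ⟨min i (m a), by omega⟩, fun _ _ hij => min_le_min_right (m a) hij⟩
  let ψ : ∀ a, Fin (m a + 1) →o Fin (n a + 1) := fun a =>
    ⟨Fin.castLE (Nat.succ_le_succ (hmn a)), fun _ _ hij => hij⟩
  refine ⟨m, φ, σ.comp (gridOfMono ψ),
    card_filter_le_of_forall_mem_not hk hD fun a ha => by simp [m, ha], ?_⟩
  have hconst : ∀ (x : (stdGrid d n).vertices), ∀ a ∈ D, (σ.toFun x : Vtx d) a = c a := by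
    intro x a ha
    have hx := ((h (x, x) x.2).2.2 a ha).1
    rwa [Hom.vApp, dif_pos x.2] at hx
  refine Hom.ext (funext fun x => Subtype.ext (funext fun a => ?_))
  by_cases ha : a ∈ D
  · exact (hconst _ a ha).trans (hconst x a ha).symm
  · refine (grid_apply σ _ a).trans ((congrArg (gcpt σ a) (Fin.ext ?_)).trans
      (grid_apply σ x a).symm)
    have hm : m a = n a := if_neg ha
    exact min_eq_left ((mem_stdGrid_vertices.mp x.2 a).trans_eq hm.symm)

theorem NerveDimLE.landsIn_trunc {I : PastingShape d} {n : Vtx d} {k : ℕ}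
    {σ : Hom (stdGrid d n) I} (h : NerveDimLE σ k) : LandsIn σ (I.trunc k) := by
  obtain ⟨m, φ, τ, hm, rfl⟩ := h
  intro p hp
  refine ⟨Hom.vApp_box _ hp, le_trans (Finset.card_le_card fun a ha => ?_) hm⟩
  simp only [Finset.mem_filter, Finset.mem_univ, true_and] at ha ⊢
  refine fun hma => ha ?_
  rw [Hom.vApp, Hom.vApp, dif_pos (fst_mem_vertices hp), dif_pos (snd_mem_vertices hp)]
  refine (grid_apply τ _ a).trans ((congrArg (gcpt τ a) ?_).trans (grid_apply τ _ a).symm)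
  have : Subsingleton (Fin (m a + 1)) := Fin.subsingleton_iff_le_one.mpr (by omega)
  exact Subsingleton.elim _ _

/-- For `0 ≤ k ≤ d`, the `k`-truncation of a pasting shape `I` is the
union of its intersections with all `k`-dimensional hyperplanes, and, as `d`-uple
simplicial subsets of the nerve `[I]`, `tr_{≤k}[I] = [tr_{≤k} I] = ⋃_{H} [I ∩ H]`. -/
theorem trunc_eq_union_hyperplanes (d k : ℕ) (hk : k ≤ d) (I : PastingShape d) :
    I.trunc k = sUnionShape {S | ∃ (D : Finset (Fin d)) (c : Vtx d),
      D.card = d - k ∧ S = PastingShape.inter I (hyperplane D c)} ∧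
    ∀ (n : Vtx d) (σ : Hom (stdGrid d n) I),
      (NerveDimLE σ k ↔ LandsIn σ (I.trunc k)) ∧
      (NerveDimLE σ k ↔ ∃ (D : Finset (Fin d)) (c : Vtx d),
        D.card = d - k ∧ LandsIn σ (PastingShape.inter I (hyperplane D c))) := by
  refine ⟨ext_boxes (Set.Subset.antisymm ?_ ?_), fun n σ => ?_⟩
  · intro p hp
    obtain ⟨D, hD, heq⟩ := exists_finset_eq_of_boxDim_le hp.2
    exact BoxClosure.base (Set.mem_iUnion₂.mpr ⟨_, ⟨D, p.1, hD, rfl⟩, hp.1, I.isBox' p hp.1,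
      fun a ha => ⟨rfl, (heq a ha).symm⟩⟩)
  · refine le_boxes (sUnionShape_le ?_)
    rintro _ ⟨D, c, hD, rfl⟩
    exact inter_hyperplane_le_trunc hk I hD c
  · have hdim : (∃ (D : Finset (Fin d)) (c : Vtx d), D.card = d - k ∧
        LandsIn σ (PastingShape.inter I (hyperplane D c))) → NerveDimLE σ k :=
      fun ⟨_, _, hD, h⟩ => nerveDimLE_of_landsIn_hyperplane hk hD h
    exact ⟨⟨fun h => h.landsIn_trunc, fun h => hdim h.exists_hyperplane⟩,
      ⟨fun h => h.landsIn_trunc.exists_hyperplane, hdim⟩⟩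

end Pasting
end

section
/- Let i : □[1,…,1] → □[n_1,…,n_d] be an injective map of d-dimensional pasting shapes. Then any map of pasting shapes □[k_1,…,k_d] → ⊡[i] factors through one of the subshapes M^σ_a[i], for some sign σ ∈ {−,+} and index 1 ≤ a ≤ d. -/
namespace Pasting

variable {d : ℕ}

open PastingShape

/-- Any map of pasting shapes `□[k_1,…,k_d] → ⊡[i]` factors through
one of the subshapes `M^σ_a[i]`. -/
theorem map_to_boxdot_factors (d : ℕ) (n : Vtx d)
    (i : Hom (stdGrid d (fun _ => 1)) (stdGrid d n))
    (hi : Function.Injective i.toFun) (k : Vtx d) (g : Hom (stdGrid d k) (boxdot i hi)) :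
    ∃ (a : Fin d) (σ : Bool), ∀ p ∈ (stdGrid d k).boxes,
      (g.vApp p.1, g.vApp p.2) ∈ (Mside i a σ).boxes := by
  have corner : ((0 : Vtx d), k) ∈ (stdGrid d k).boxes := fun a => ⟨Nat.zero_le _, le_rfl⟩
  have h0 := fst_mem_vertices corner
  have hk := snd_mem_vertices corner
  obtain ⟨-, a, ha⟩ := g.vApp_box corner
  have bounds : ∀ x ∈ (stdGrid d k).vertices, g.vApp 0 a ≤ g.vApp x a ∧ g.vApp x a ≤ g.vApp k a :=
    fun x hx => ⟨vApp_coord_le g h0 hx a (Nat.zero_le _),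
      vApp_coord_le g hx hk a (mem_stdGrid_vertices.mp hx a)⟩
  rcases ha with ha | ha
  · exact ⟨a, false, fun p hp => ⟨(g.vApp_box hp).1,
      (bounds _ (fst_mem_vertices hp)).2.trans ha, (bounds _ (snd_mem_vertices hp)).2.trans ha⟩⟩
  · exact ⟨a, true, fun p hp => ⟨(g.vApp_box hp).1,
      ha.trans (bounds _ (fst_mem_vertices hp)).1, ha.trans (bounds _ (snd_mem_vertices hp)).1⟩⟩

end Pasting
end

section
/- Let I be a d-dimensional pasting shape and let f : □[n_1,…,n_d] → I and g : □[m_1,…,m_d] → I be injective maps with intersecting images. Then there exist l_1,…,l_d ∈ ℕ and injective maps i : □[l_1,…,l_d] → □[n_1,…,n_d] and j : □[l_1,…,l_d] → □[m_1,…,m_d] with f∘i = g∘j and im((f∘i)_a) = im(f_a) ∩ im(g_a) for all a, such that the resulting square is a pullback in the category of pasting shapes: for every pair of maps u : □[k_1,…,k_d] → □[n_1,…,n_d] and v : □[k_1,…,k_d] → □[m_1,…,m_d] with f∘u = g∘v, there is a unique map w : □[k_1,…,k_d] → □[l_1,…,l_d] with i∘w = u and j∘w = v. -/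
namespace Pasting

variable {d : ℕ}

open PastingShape

/-- A map out of a standard grid composed with a map induced by monotone maps is computed
componentwise. -/
theorem gcpt_comp_gridOfMono {l n : Vtx d} {I : PastingShape d} (f : Hom (stdGrid d n) I)
    (φ : ∀ a, Fin (l a + 1) →o Fin (n a + 1)) (a : Fin d) (t : Fin (l a + 1)) :
    gcpt (f.comp (gridOfMono φ)) a t = gcpt f a (φ a t) := by
  refine (grid_apply f _ a).trans (congrArg (gcpt f a) (Fin.ext ?_))
  refine congrArg (fun s => ((φ a s : Fin (n a + 1)) : ℕ)) (Fin.ext ?_)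
  simp [unitVtx]

/-- Maps out of a standard grid are determined by their components. -/
theorem hom_ext_gcpt {n : Vtx d} {I : PastingShape d} {f g : Hom (stdGrid d n) I}
    (h : ∀ a t, gcpt f a t = gcpt g a t) : f = g := by
  refine Hom.ext (funext fun x => Subtype.ext (funext fun a => ?_))
  rw [grid_apply f x a, grid_apply g x a, h]

theorem gcpt_le {k n : Vtx d} (u : Hom (stdGrid d k) (stdGrid d n)) (a : Fin d)
    (t : Fin (k a + 1)) : gcpt u a t ≤ n a :=
  mem_stdGrid_vertices.mp (u.toFun _).2 a

/-- The components of a map between standard grids, as monotone maps. -/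
def gcptHom {k n : Vtx d} (u : Hom (stdGrid d k) (stdGrid d n)) (a : Fin d) :
    Fin (k a + 1) →o Fin (n a + 1) where
  toFun t := ⟨gcpt u a t, Nat.lt_succ_of_le (gcpt_le u a t)⟩
  monotone' _ _ h := gcpt_mono u a h

theorem gridOfMono_gcptHom {k n : Vtx d} (u : Hom (stdGrid d k) (stdGrid d n)) :
    gridOfMono (gcptHom u) = u :=
  Hom.ext (funext fun x => Subtype.ext (funext fun a => (grid_apply u x a).symm))

theorem gcpt_comp {k n : Vtx d} {I : PastingShape d} (f : Hom (stdGrid d n) I)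
    (u : Hom (stdGrid d k) (stdGrid d n)) (a : Fin d) (t : Fin (k a + 1)) :
    gcpt (f.comp u) a t = gcpt f a (gcptHom u a t) := by
  conv_lhs => rw [← gridOfMono_gcptHom u]
  exact gcpt_comp_gridOfMono f _ a t

theorem gcpt_strictMono {n : Vtx d} {I : PastingShape d} {f : Hom (stdGrid d n) I}
    (hf : Function.Injective f.toFun) (a : Fin d) : StrictMono (gcpt f a) := by
  refine (gcpt_mono f a).strictMono_of_injective fun s t hst => ?_
  have hs : unitVtx a (s : ℕ) ∈ (stdGrid d n).vertices := unitVtx_mem (Nat.lt_succ_iff.mp s.isLt)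
  have ht : unitVtx a (t : ℕ) ∈ (stdGrid d n).vertices := unitVtx_mem (Nat.lt_succ_iff.mp t.isLt)
  have heq : f.toFun ⟨_, hs⟩ = f.toFun ⟨_, ht⟩ := by
    refine Subtype.ext (funext fun b => ?_)
    by_cases hb : b = a
    · subst hb
      exact hst
    · rw [grid_apply f _ b, grid_apply f _ b]
      exact congrArg (gcpt f b) (Fin.ext (by simp [unitVtx, hb]))
  have hval := congrFun (congrArg Subtype.val (hf heq)) a
  simpa [unitVtx, Fin.ext_iff] using hval

theorem injective_of_gcpt_injective {n : Vtx d} {I : PastingShape d} {f : Hom (stdGrid d n) I}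
    (hf : ∀ a, Function.Injective (gcpt f a)) : Function.Injective f.toFun := by
  refine fun x y hxy => Subtype.ext (funext fun a => ?_)
  have h := congrFun (congrArg Subtype.val hxy) a
  rw [grid_apply f x a, grid_apply f y a] at h
  exact congrArg Fin.val (hf a h)

/-- The intersection of the ranges of two strictly monotone finite sequences is enumerated
by a common subsequence. -/
theorem exists_common_subsequence {N M : ℕ} {φ : Fin (N + 1) → ℕ} {ψ : Fin (M + 1) → ℕ}
    (hφ : StrictMono φ) (hψ : StrictMono ψ) (hne : (Set.range φ ∩ Set.range ψ).Nonempty) :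
    ∃ (L : ℕ) (α : Fin (L + 1) →o Fin (N + 1)) (β : Fin (L + 1) →o Fin (M + 1)),
      StrictMono α ∧ StrictMono β ∧ (∀ t, φ (α t) = ψ (β t)) ∧
      Set.range (fun t => φ (α t)) = Set.range φ ∩ Set.range ψ := by
  classical
  set S : Finset ℕ := Finset.univ.image φ ∩ Finset.univ.image ψ with hS
  have hSc : (S : Set ℕ) = Set.range φ ∩ Set.range ψ := by simp [hS]
  have hSne : S.Nonempty := by rw [← Finset.coe_nonempty, hSc]; exact hne
  have hcard : S.card = S.card - 1 + 1 := (Nat.succ_pred_eq_of_pos hSne.card_pos).symm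
  set e := S.orderEmbOfFin hcard
  have he : Set.range e = Set.range φ ∩ Set.range ψ := by
    rw [← hSc]; exact Finset.range_orderEmbOfFin S hcard
  have hmem : ∀ t, e t ∈ Set.range φ ∩ Set.range ψ := fun t => he ▸ Set.mem_range_self t
  choose α hα using fun t => (hmem t).1
  choose β hβ using fun t => (hmem t).2
  have hαm : StrictMono α := fun s t hst => by
    rw [← hφ.lt_iff_lt, hα, hα]; exact e.strictMono hst
  have hβm : StrictMono β := fun s t hst => by
    rw [← hψ.lt_iff_lt, hβ, hβ]; exact e.strictMono hst
  refine ⟨S.card - 1, ⟨α, hαm.monotone⟩, ⟨β, hβm.monotone⟩, hαm, hβm,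
    fun t => (hα t).trans (hβ t).symm, ?_⟩
  rw [← he]
  exact congrArg Set.range (funext hα)

/-- Injective maps of pasting shapes are monomorphisms. -/
theorem hom_cancel_left {I J K : PastingShape d} {f : Hom J K} (hf : Function.Injective f.toFun)
    {u v : Hom I J} (h : f.comp u = f.comp v) : u = v :=
  Hom.ext (hf.comp_left (congrArg Hom.toFun h))

/-- Two injective maps of standard grids into a pasting shape with
intersecting images admit a pullback in the category of pasting shapes, which is again
a standard grid, with component images the intersections of the component images. -/
theorem grid_pullback (d : ℕ) (I : PastingShape d) (n m : Vtx d)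
    (f : Hom (stdGrid d n) I) (g : Hom (stdGrid d m) I)
    (hf : Function.Injective f.toFun) (hg : Function.Injective g.toFun)
    (hmeet : ∃ (v : (stdGrid d n).vertices) (w : (stdGrid d m).vertices),
      (f.toFun v : Vtx d) = (g.toFun w : Vtx d)) :
    ∃ (l : Vtx d) (i : Hom (stdGrid d l) (stdGrid d n)) (j : Hom (stdGrid d l) (stdGrid d m)),
      Function.Injective i.toFun ∧ Function.Injective j.toFun ∧
      f.comp i = g.comp j ∧
      (∀ a, gcptRange (f.comp i) a = gcptRange f a ∩ gcptRange g a) ∧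
      ∀ (k : Vtx d) (u : Hom (stdGrid d k) (stdGrid d n))
        (v : Hom (stdGrid d k) (stdGrid d m)), f.comp u = g.comp v →
        ∃! w : Hom (stdGrid d k) (stdGrid d l), i.comp w = u ∧ j.comp w = v := by
  have hφ := gcpt_strictMono hf
  have hψ := gcpt_strictMono hg
  have hne : ∀ a, (Set.range (gcpt f a) ∩ Set.range (gcpt g a)).Nonempty := by
    obtain ⟨v, w, hvw⟩ := hmeet
    intro a
    have h := congrFun hvw a
    rw [grid_apply f v a, grid_apply g w a] at h
    exact ⟨_, ⟨_, rfl⟩, ⟨_, h.symm⟩⟩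
  choose l α β hα hβ hαβ hrange using fun a => exists_common_subsequence (hφ a) (hψ a) (hne a)
  have hfi : ∀ a t, gcpt (f.comp (gridOfMono α)) a t = gcpt f a (α a t) :=
    gcpt_comp_gridOfMono f α
  have hcomm : f.comp (gridOfMono α) = g.comp (gridOfMono β) := hom_ext_gcpt fun a t => by
    rw [hfi, gcpt_comp_gridOfMono, hαβ]
  have hinj : Function.Injective (f.comp (gridOfMono α)).toFun :=
    injective_of_gcpt_injective fun a s t hst => by
      rw [hfi, hfi] at hst
      exact (hα a).injective ((hφ a).injective hst)
  have hi : Function.Injective (gridOfMono α).toFun := Function.Injective.of_comp hinj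
  have hj : Function.Injective (gridOfMono β).toFun := by
    rw [hcomm] at hinj
    exact Function.Injective.of_comp hinj
  refine ⟨l, gridOfMono α, gridOfMono β, hi, hj, hcomm, fun a => ?_, fun k u v huv => ?_⟩
  · rw [gcptRange, funext (hfi a)]
    exact hrange a
  · have hlift : ∀ a t, ∃ s, gcpt f a (α a s) = gcpt f a (gcptHom u a t) := fun a t => by
      have hmem : gcpt f a (gcptHom u a t) ∈ Set.range (gcpt f a) ∩ Set.range (gcpt g a) :=
        ⟨⟨_, rfl⟩, ⟨gcptHom v a t, by rw [← gcpt_comp, ← gcpt_comp, huv]⟩⟩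
      rwa [← hrange a] at hmem
    choose ω hω using hlift
    have hωm : ∀ a, Monotone (ω a) := fun a s t hst => by
      rw [← (hα a).le_iff_le, ← (hφ a).le_iff_le, hω, hω]
      exact (hφ a).monotone ((gcptHom u a).monotone hst)
    have hfw : f.comp ((gridOfMono α).comp (gridOfMono fun a => ⟨ω a, hωm a⟩)) = f.comp u :=
      hom_ext_gcpt fun a t => by
        rw [gcpt_comp f u, ← hω, ← hfi]
        exact gcpt_comp_gridOfMono (f.comp (gridOfMono α)) _ a t
    have hgw : g.comp ((gridOfMono β).comp (gridOfMono fun a => ⟨ω a, hωm a⟩)) = g.comp v := by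
      rw [← huv, ← hfw]
      exact congrArg (fun h => h.comp (gridOfMono fun a => ⟨ω a, hωm a⟩)) hcomm.symm
    refine ⟨gridOfMono fun a => ⟨ω a, hωm a⟩, ⟨hom_cancel_left hf hfw, hom_cancel_left hg hgw⟩,
      fun w hw => hom_cancel_left hi (hw.1.trans (hom_cancel_left hf hfw).symm)⟩

end Pasting
end
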